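/- arXiv:1602.00406 — 3 statements merged into one kernel-verified Lean document; each statement's English description precedes it below -/
import Mathlib

section
/- Let Ω(x) = (2/π)·(x·arcsin(x/2) + √(4−x²)) for |x| ≤ 2. Then ∫_{−2}^{2} (Ω(x) − x)² dx = 32/3 + 1024/(27π²). -/
open MeasureTheory Real

/-- For the Logan–Shepp–Vershik–Kerov limit shape
`Ω(x) = (2/π)(x·arcsin(x/2) + √(4-x²))` on `[-2,2]`,
`∫_{-2}^2 (Ω(x) - x)² dx = 32/3 + 1024/(27π²)`. -/
theorem integral_limit_shape_sq :
    ∫ x in (-2 : ℝ)..2,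
        ((2 / π) * (x * Real.arcsin (x / 2) + Real.sqrt (4 - x ^ 2)) - x) ^ 2 =
      32 / 3 + 1024 / (27 * π ^ 2) := by
  have hpi : π ≠ 0 := Real.pi_ne_zero
  have hca : Continuous fun x : ℝ => Real.arcsin (x / 2) :=
    Real.continuous_arcsin.comp (by fun_prop)
  have hcs : Continuous fun x : ℝ => Real.sqrt (4 - x ^ 2) :=
    Real.continuous_sqrt.comp (by fun_prop)
  obtain ⟨c, hc⟩ : ∃ c : ℝ, c = 2 / π := ⟨_, rfl⟩
  rw [← hc]
  have key := intervalIntegral.integral_eq_sub_of_hasDerivAt_of_le (a := (-2 : ℝ)) (b := 2)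
    (f := fun x : ℝ =>
      c ^ 2 * (x ^ 3 * Real.arcsin (x / 2) ^ 2 / 3
        + (2 / 9) * ((x ^ 2 + 8) * Real.sqrt (4 - x ^ 2) * Real.arcsin (x / 2))
        - (2 / 9) * (x ^ 3 / 3 + 8 * x)
        - (2 / 3) * (Real.sqrt (4 - x ^ 2) ^ 3 * Real.arcsin (x / 2))
        + (5 / 3) * (4 * x - x ^ 3 / 3))
      - 2 * c * (x ^ 3 * Real.arcsin (x / 2) / 3 + (x ^ 2 + 8) * Real.sqrt (4 - x ^ 2) / 9
        - Real.sqrt (4 - x ^ 2) ^ 3 / 3) + x ^ 3 / 3)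
    (f' := fun x : ℝ => (c * (x * Real.arcsin (x / 2) + Real.sqrt (4 - x ^ 2)) - x) ^ 2)
    (by norm_num) (by fun_prop) ?_ ?_
  · rw [key]
    have e1 : (2 : ℝ) / 2 = 1 := by norm_num
    have e2 : (-2 : ℝ) / 2 = -1 := by norm_num
    have e3 : (4 : ℝ) - 2 ^ 2 = 0 := by norm_num
    have e4 : (4 : ℝ) - (-2) ^ 2 = 0 := by norm_num
    simp only [e1, e2, e3, e4, Real.arcsin_one, Real.arcsin_neg_one, Real.sqrt_zero, hc]
    field_simp
    ring
  · intro x hx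
    have hpos : 0 < 4 - x ^ 2 := by nlinarith [hx.1, hx.2]
    have hs0 : Real.sqrt (4 - x ^ 2) ≠ 0 := (Real.sqrt_pos.2 hpos).ne'
    have hsq : Real.sqrt (4 - x ^ 2) ^ 2 = 4 - x ^ 2 := Real.sq_sqrt hpos.le
    have ds : HasDerivAt (fun x : ℝ => Real.sqrt (4 - x ^ 2)) (-x / Real.sqrt (4 - x ^ 2)) x := by
      have h0 : HasDerivAt (fun x : ℝ => 4 - x ^ 2) (-(2 * x)) x := by
        simpa using (hasDerivAt_pow 2 x).const_sub 4
      refine (h0.sqrt hpos.ne').congr_deriv ?_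
      field_simp
    have da : HasDerivAt (fun x : ℝ => Real.arcsin (x / 2)) (1 / Real.sqrt (4 - x ^ 2)) x := by
      have h := (Real.hasDerivAt_arcsin (x := x / 2) (by linarith [hx.1]) (by linarith [hx.2])).comp x
        ((hasDerivAt_id x).div_const 2)
      refine HasDerivAt.congr_deriv h ?_
      have : Real.sqrt (4 - x ^ 2) = 2 * Real.sqrt (1 - (x / 2) ^ 2) := by
        rw [show 4 - x ^ 2 = 2 ^ 2 * (1 - (x / 2) ^ 2) by ring,
          Real.sqrt_mul (by norm_num), Real.sqrt_sq (by norm_num)]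
      rw [this]
      rw [this] at hs0
      field_simp
    have d1 : HasDerivAt (fun x : ℝ => x) 1 x := hasDerivAt_id x
    have d3 : HasDerivAt (fun x : ℝ => x ^ 3) (3 * x ^ 2) x := by
      simpa using hasDerivAt_pow 3 x
    have dx8 : HasDerivAt (fun x : ℝ => x ^ 2 + 8) (2 * x) x := by
      simpa using (hasDerivAt_pow 2 x).add_const 8
    have D := ((((((((d3.mul (da.pow 2)).div_const 3).add
      (((dx8.mul ds).mul da).const_mul (2 / 9))).sub
      (((d3.div_const 3).add (d1.const_mul 8)).const_mul (2 / 9))).sub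
      (((ds.pow 3).mul da).const_mul (2 / 3))).add
      (((d1.const_mul 4).sub (d3.div_const 3)).const_mul (5 / 3))).const_mul (c ^ 2)).sub
      (((((d3.mul da).div_const 3).add ((dx8.mul ds).div_const 9)).sub
        ((ds.pow 3).div_const 3)).const_mul (2 * c))).add (d3.div_const 3)
    refine D.congr_deriv ?_
    simp only [Pi.pow_apply, Pi.mul_apply, id]
    generalize Real.sqrt (4 - x ^ 2) = s at *
    generalize Real.arcsin (x / 2) = a
    have hx2 : x ^ 2 = 4 - s ^ 2 := by linarith
    push_cast
    field_simp
    grind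
  · apply Continuous.intervalIntegrable
    fun_prop
end

section
/- Let m ≥ 2 and let ξ_1, …, ξ_m be i.i.d. random variables with the exponential density e^{-x}·1_{x ≥ 0}. Set Y = (ξ_1² + ⋯ + ξ_m²)/(ξ_1 + ⋯ + ξ_m)². Then E[Y] = 2/(m+1), E[Y²] = (4m+20)/((m+1)(m+2)(m+3)), and consequently E[Y²] − (E[Y])² = 4(m−1)/((m+1)²(m+2)(m+3)). -/
open MeasureTheory ProbabilityTheory Finset Real
noncomputable def expPi (m : ℕ) : Measure (Fin m → ℝ) :=
  Measure.pi fun _ => expMeasure 1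

lemma gammaL (j : ℕ) {r : ℝ} (hr : 0 < r) :
    ∫⁻ t in Set.Ioi (0:ℝ), ENNReal.ofReal (t ^ j * exp (-(r * t))) =
      ENNReal.ofReal (j.factorial / r ^ (j + 1)) := by
  have key : ∫ t in Set.Ioi (0:ℝ), t ^ j * exp (-(r * t)) = j.factorial / r ^ (j + 1) := by
    have h := Real.integral_rpow_mul_exp_neg_mul_Ioi (a := (j:ℝ) + 1) (by positivity) hr
    rw [Real.Gamma_nat_eq_factorial] at h
    have e : (1 / r) ^ ((j:ℝ) + 1) = 1 / r ^ (j + 1) := by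
      have : ((j:ℝ) + 1) = ((j + 1 : ℕ) : ℝ) := by push_cast; rfl
      rw [this, Real.rpow_natCast, div_pow, one_pow]
    rw [e] at h
    simp only [add_sub_cancel_right, Real.rpow_natCast] at h
    rw [h]; ring
  rw [← key, ofReal_integral_eq_lintegral_ofReal]
  · apply Integrable.of_integral_ne_zero
    rw [key]; positivity
  · filter_upwards [ae_restrict_mem measurableSet_Ioi] with t ht
    have : (0:ℝ) < t := ht
    positivity

lemma expL (f : ℝ → ENNReal) (hf : Measurable f) :
    ∫⁻ x, f x ∂(expMeasure 1) = ∫⁻ x in Set.Ioi (0:ℝ), ENNReal.ofReal (exp (-x)) * f x := by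
  have hm : Measurable (gammaPDF 1 1) := (measurable_gammaPDFReal 1 1).ennreal_ofReal
  rw [expMeasure, gammaMeasure, lintegral_withDensity_eq_lintegral_mul _ hm hf,
    ← lintegral_indicator measurableSet_Ioi]
  apply lintegral_congr_ae
  have : ∀ᵐ x : ℝ, x ≠ 0 := by simp [ae_iff]
  filter_upwards [this] with x hx
  rcases lt_or_gt_of_ne hx with h | h
  · simp [gammaPDF_of_neg h, h.le]
  · simp [h, gammaPDF_of_nonneg h.le]

instance : IsProbabilityMeasure (expMeasure 1) := isProbabilityMeasure_expMeasure one_pos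

instance (m : ℕ) : IsProbabilityMeasure (expPi m) := by unfold expPi; infer_instance

lemma exp_pos_ae : ∀ᵐ x ∂(expMeasure 1), 0 < x := by
  have h := expL ((Set.Iic 0).indicator 1) (measurable_one.indicator measurableSet_Iic)
  rw [lintegral_indicator_one measurableSet_Iic] at h
  rw [ae_iff]
  have e : {a : ℝ | ¬ 0 < a} = Set.Iic 0 := by ext; simp
  rw [e, h, ← lintegral_zero (μ := volume.restrict (Set.Ioi (0:ℝ)))]
  apply setLIntegral_congr_fun measurableSet_Ioi
  intro x hx
  have : (0:ℝ) < x := hx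
  simp [this]

lemma expPi_pos_ae (m : ℕ) : ∀ᵐ x ∂(expPi m), ∀ i, 0 < x i := by
  rw [ae_all_iff]
  intro i
  exact (Measure.tendsto_eval_ae_ae (μ := fun _ : Fin m => expMeasure 1) (i := i)).eventually
    exp_pos_ae

lemma piL (m : ℕ) (f : Fin m → ℝ → ENNReal) (hf : ∀ i, Measurable (f i)) :
    ∫⁻ x, ∏ i, f i (x i) ∂(expPi m) = ∏ i, ∫⁻ x, f i x ∂(expMeasure 1) := by
  have hi : iIndepFun (fun (i : Fin m) (x : Fin m → ℝ) => f i (x i)) (expPi m) :=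
    iIndepFun_pi (fun i => (hf i).aemeasurable)
  have := lintegral_prod_eq_prod_lintegral_of_indepFun (μ := expPi m) Finset.univ
    (fun (i : Fin m) (x : Fin m → ℝ) => f i (x i)) hi (fun i => (hf i).comp (measurable_pi_apply i))
  rw [this]
  refine Finset.prod_congr rfl fun i _ => ?_
  exact (measurePreserving_eval (fun _ : Fin m => expMeasure 1) i).lintegral_comp (hf i)

lemma betaL (k n : ℕ) :
    ∫⁻ t in Set.Ioi (0:ℝ), ENNReal.ofReal (t ^ k / (1 + t) ^ (n + k + 2)) =
      ENNReal.ofReal (k.factorial * n.factorial / (n + k + 1).factorial) := by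
  have h1 : ∀ t ∈ Set.Ioi (0:ℝ), ENNReal.ofReal (t ^ k / (1 + t) ^ (n + k + 2)) =
      ∫⁻ s in Set.Ioi (0:ℝ), ENNReal.ofReal
        (t ^ k / (n + k + 1).factorial * (s ^ (n + k + 1) * exp (-((1 + t) * s)))) := by
    intro t ht
    have ht : (0:ℝ) < t := ht
    simp_rw [ENNReal.ofReal_mul (show 0 ≤ t ^ k / ((n + k + 1).factorial : ℝ) by positivity)]
    rw [lintegral_const_mul _ (by fun_prop), gammaL _ (by positivity),
      ← ENNReal.ofReal_mul (by positivity)]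
    congr 1
    have : ((n + k + 1).factorial : ℝ) ≠ 0 := by positivity
    field_simp
  rw [setLIntegral_congr_fun measurableSet_Ioi h1, lintegral_lintegral_swap (by fun_prop)]
  have h2 : ∀ s ∈ Set.Ioi (0:ℝ), ∫⁻ t in Set.Ioi (0:ℝ), ENNReal.ofReal
        (t ^ k / (n + k + 1).factorial * (s ^ (n + k + 1) * exp (-((1 + t) * s)))) =
      ENNReal.ofReal (k.factorial / (n + k + 1).factorial) *
        ENNReal.ofReal (s ^ n * exp (-(1 * s))) := by
    intro s hs
    have hs : (0:ℝ) < s := hs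
    have : ∀ t, t ^ k / ((n + k + 1).factorial : ℝ) * (s ^ (n + k + 1) * exp (-((1 + t) * s))) =
      (s ^ (n + k + 1) * exp (-s) / (n + k + 1).factorial) * (t ^ k * exp (-(s * t))) := by
      intro t
      have : exp (-((1 + t) * s)) = exp (-s) * exp (-(s * t)) := by
        rw [← Real.exp_add]; ring_nf
      rw [this]; ring
    simp_rw [this, ENNReal.ofReal_mul
      (show 0 ≤ s ^ (n + k + 1) * exp (-s) / ((n + k + 1).factorial : ℝ) by positivity)]
    rw [lintegral_const_mul _ (by fun_prop), gammaL _ (by positivity),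
      ← ENNReal.ofReal_mul (by positivity), ← ENNReal.ofReal_mul (by positivity)]
    congr 1
    have : ((n + k + 1).factorial : ℝ) ≠ 0 := by positivity
    field_simp
    ring_nf
  rw [setLIntegral_congr_fun measurableSet_Ioi h2, lintegral_const_mul _ (by fun_prop),
    gammaL _ one_pos, ← ENNReal.ofReal_mul (by positivity)]
  congr 1
  simp; ring

lemma monoL (n : ℕ) (a : Fin (n + 1) → ℕ) (k : ℕ) (ha : ∑ i, a i = k + 1) :
    ∫⁻ x, ENNReal.ofReal ((∏ i, x i ^ a i) / (∑ i, x i) ^ (k + 1)) ∂(expPi (n + 1)) =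
      ENNReal.ofReal ((∏ i, ((a i).factorial : ℝ)) * (n.factorial / (n + k + 1).factorial)) := by
  have h1 : ∀ᵐ x ∂(expPi (n + 1)),
      ENNReal.ofReal ((∏ i, x i ^ a i) / (∑ i, x i) ^ (k + 1)) =
      ∫⁻ t in Set.Ioi (0:ℝ), ENNReal.ofReal
        ((∏ i, x i ^ a i) / k.factorial * (t ^ k * exp (-((∑ i, x i) * t)))) := by
    filter_upwards [expPi_pos_ae (n + 1)] with x hx
    have hS : 0 < ∑ i, x i := Finset.sum_pos (fun i _ => hx i) ⟨0, by simp⟩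
    have hP : 0 ≤ ∏ i, x i ^ a i := Finset.prod_nonneg fun i _ => (pow_pos (hx i) _).le
    simp_rw [ENNReal.ofReal_mul (show 0 ≤ (∏ i, x i ^ a i) / (k.factorial : ℝ) by positivity)]
    rw [lintegral_const_mul _ (by fun_prop), gammaL _ hS, ← ENNReal.ofReal_mul (by positivity)]
    congr 1
    have : (k.factorial : ℝ) ≠ 0 := by positivity
    field_simp
  rw [lintegral_congr_ae h1, lintegral_lintegral_swap (by fun_prop)]
  have h2 : ∀ t ∈ Set.Ioi (0:ℝ), ∫⁻ x, ENNReal.ofReal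
        ((∏ i, x i ^ a i) / k.factorial * (t ^ k * exp (-((∑ i, x i) * t)))) ∂(expPi (n + 1)) =
      ENNReal.ofReal ((∏ i, ((a i).factorial : ℝ)) / k.factorial) *
        ENNReal.ofReal (t ^ k / (1 + t) ^ (n + k + 2)) := by
    intro t ht
    have ht : (0:ℝ) < t := ht
    have e1 : ∀ᵐ x ∂(expPi (n + 1)), ENNReal.ofReal
        ((∏ i, x i ^ a i) / k.factorial * (t ^ k * exp (-((∑ i, x i) * t)))) =
        ENNReal.ofReal (t ^ k / k.factorial) *
          ∏ i, ENNReal.ofReal (x i ^ a i * exp (-(t * x i))) := by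
      filter_upwards [expPi_pos_ae (n + 1)] with x hx
      rw [← ENNReal.ofReal_prod_of_nonneg
        (fun i _ => mul_nonneg (pow_pos (hx i) _).le (exp_pos _).le),
        ← ENNReal.ofReal_mul (by positivity), Finset.prod_mul_distrib, ← Real.exp_sum,
        Finset.sum_neg_distrib, ← Finset.mul_sum]
      congr 1
      rw [mul_comm t]; ring
    rw [lintegral_congr_ae e1, lintegral_const_mul _ (by fun_prop),
      piL _ (fun i y => ENNReal.ofReal (y ^ a i * exp (-(t * y)))) (fun i => by fun_prop)]
    have e2 : ∀ i, ∫⁻ y, ENNReal.ofReal (y ^ a i * exp (-(t * y))) ∂(expMeasure 1) =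
        ENNReal.ofReal ((a i).factorial / (1 + t) ^ (a i + 1)) := by
      intro i
      rw [expL _ (by fun_prop), ← gammaL _ (by positivity)]
      refine lintegral_congr fun y => ?_
      rw [← ENNReal.ofReal_mul (by positivity)]
      congr 1
      have : exp (-((1 + t) * y)) = exp (-y) * exp (-(t * y)) := by
        rw [← Real.exp_add]; ring_nf
      rw [this]; ring
    simp_rw [e2]
    rw [← ENNReal.ofReal_prod_of_nonneg (fun i _ => by positivity),
      ← ENNReal.ofReal_mul (by positivity), ← ENNReal.ofReal_mul (by positivity),
      Finset.prod_div_distrib, Finset.prod_pow_eq_pow_sum, Finset.sum_add_distrib, ha]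
    congr 1
    simp only [sum_const, card_univ, Fintype.card_fin, smul_eq_mul, mul_one]
    rw [show k + 1 + (n + 1) = n + k + 2 by ring]
    ring
  rw [setLIntegral_congr_fun measurableSet_Ioi h2, lintegral_const_mul _ (by fun_prop),
    betaL, ← ENNReal.ofReal_mul (by positivity)]
  congr 1
  have : (k.factorial : ℝ) ≠ 0 := by positivity
  field_simp

lemma monoI (n : ℕ) (a : Fin (n + 1) → ℕ) (k : ℕ) (ha : ∑ i, a i = k + 1) :
    Integrable (fun x => (∏ i, x i ^ a i) / (∑ i, x i) ^ (k + 1)) (expPi (n + 1)) ∧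
    ∫ x, (∏ i, x i ^ a i) / (∑ i, x i) ^ (k + 1) ∂(expPi (n + 1)) =
      (∏ i, ((a i).factorial : ℝ)) * (n.factorial / (n + k + 1).factorial) := by
  have key : ∫ x, (∏ i, x i ^ a i) / (∑ i, x i) ^ (k + 1) ∂(expPi (n + 1)) =
      (∏ i, ((a i).factorial : ℝ)) * (n.factorial / (n + k + 1).factorial) := by
    rw [integral_eq_lintegral_of_nonneg_ae, monoL n a k ha, ENNReal.toReal_ofReal (by positivity)]
    · filter_upwards [expPi_pos_ae (n + 1)] with x hx
      have hS : 0 < ∑ i, x i := Finset.sum_pos (fun i _ => hx i) ⟨0, by simp⟩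
      have hP : 0 ≤ ∏ i, x i ^ a i := Finset.prod_nonneg fun i _ => (pow_pos (hx i) _).le
      simp only [Pi.zero_apply]
      positivity
    · exact Measurable.aestronglyMeasurable (by fun_prop)
  refine ⟨Integrable.of_integral_ne_zero ?_, key⟩
  rw [key]
  have : (∏ i, ((a i).factorial : ℝ)) ≠ 0 := Finset.prod_ne_zero_iff.2 fun i _ => by positivity
  positivity

lemma first (n : ℕ) : ∫ x : Fin (n+1) → ℝ, (∑ i, (x i) ^ 2) / (∑ i, x i) ^ 2 ∂(expPi (n+1)) =
    2 / ((n : ℝ) + 2) := by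
  have h : ∀ i : Fin (n+1), Integrable (fun x => x i ^ 2 / (∑ i, x i) ^ 2) (expPi (n+1)) ∧
      ∫ x, x i ^ 2 / (∑ i, x i) ^ 2 ∂(expPi (n+1)) = 2 / (((n:ℝ) + 1) * (n + 2)) := by
    intro i
    have := monoI n (Pi.single i 2) 1 (by simp)
    have e1 : ∀ x : Fin (n+1) → ℝ, ∏ j, x j ^ ((Pi.single i 2 : Fin (n+1) → ℕ) j) = x i ^ 2 := by
      intro x
      rw [Finset.prod_eq_single i] <;> simp +contextual [Pi.single_apply]
    have e2 : ∏ j, ((((Pi.single i 2 : Fin (n+1) → ℕ) j).factorial : ℕ) : ℝ) = 2 := by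
      rw [Finset.prod_eq_single i] <;> simp +contextual [Pi.single_apply]
    simp only [e1, e2] at this
    refine ⟨this.1, this.2.trans ?_⟩
    rw [show n + 1 + 1 = n + 2 by rfl]
    simp only [Nat.factorial_succ]
    push_cast
    have : (n.factorial : ℝ) ≠ 0 := by positivity
    field_simp
    ring
  simp_rw [Finset.sum_div]
  rw [integral_finsetSum _ fun i _ => (h i).1]
  simp only [(h _).2]
  simp
  field_simp

lemma second (n : ℕ) :
    ∫ x : Fin (n+1) → ℝ, ((∑ i, (x i) ^ 2) / (∑ i, x i) ^ 2) ^ 2 ∂(expPi (n+1)) =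
    (4 * (n : ℝ) + 24) / (((n:ℝ) + 2) * (n + 3) * (n + 4)) := by
  have h : ∀ i j : Fin (n+1),
      Integrable (fun x => x i ^ 2 * x j ^ 2 / (∑ i, x i) ^ 4) (expPi (n+1)) ∧
      ∫ x, x i ^ 2 * x j ^ 2 / (∑ i, x i) ^ 4 ∂(expPi (n+1)) =
        (4 + if i = j then 20 else 0) / (((n:ℝ) + 1) * (n + 2) * (n + 3) * (n + 4)) := by
    intro i j
    have := monoI n (Pi.single i 2 + Pi.single j 2) 3 (by simp [Finset.sum_add_distrib])
    have e0 : ∀ (i : Fin (n+1)) (x : Fin (n+1) → ℝ),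
        ∏ j, x j ^ ((Pi.single i 2 : Fin (n+1) → ℕ) j) = x i ^ 2 := by
      intro i x
      rw [Finset.prod_eq_single i] <;> simp +contextual [Pi.single_apply]
    have e1 : ∀ x : Fin (n+1) → ℝ,
        ∏ l, x l ^ ((Pi.single i 2 + Pi.single j 2 : Fin (n+1) → ℕ) l) = x i ^ 2 * x j ^ 2 := by
      intro x
      simp only [Pi.add_apply, pow_add, Finset.prod_mul_distrib, e0]
    have e2 : ∏ l, ((((Pi.single i 2 + Pi.single j 2 : Fin (n+1) → ℕ) l).factorial : ℕ) : ℝ) =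
        4 + if i = j then 20 else 0 := by
      by_cases hij : i = j
      · subst hij
        rw [Finset.prod_eq_single i] <;> simp +contextual [Pi.single_apply]
        norm_num [Nat.factorial]
      · rw [Finset.prod_eq_mul i j hij] <;> simp +contextual [Pi.single_apply, hij, Ne.symm hij]
        norm_num
    simp only [e1, e2] at this
    refine ⟨this.1, this.2.trans ?_⟩
    rw [show n + 3 + 1 = n + 4 by rfl]
    simp only [Nat.factorial_succ]
    push_cast
    have : (n.factorial : ℝ) ≠ 0 := by positivity
    field_simp
    ring
  have e : ∀ x : Fin (n+1) → ℝ, ((∑ i, (x i) ^ 2) / (∑ i, x i) ^ 2) ^ 2 =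
      ∑ i, ∑ j, x i ^ 2 * x j ^ 2 / (∑ i, x i) ^ 4 := by
    intro x
    simp_rw [← Finset.sum_div]
    rw [← Finset.sum_mul_sum, div_pow]
    ring
  simp_rw [e]
  rw [integral_finsetSum _ fun i _ => integrable_finsetSum _ fun j _ => (h i j).1]
  simp_rw [integral_finsetSum _ fun j _ => (h _ j).1, (h _ _).2, ← Finset.sum_div,
    Finset.sum_add_distrib]
  simp
  field_simp
  ring

/-- Moments of `Y = (ξ₁²+⋯+ξ_m²)/(ξ₁+⋯+ξ_m)²` for i.i.d. standard exponentials: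
`E[Y] = 2/(m+1)`, `E[Y²] = (4m+20)/((m+1)(m+2)(m+3))`, and hence
`E[Y²] - (E[Y])² = 4(m-1)/((m+1)²(m+2)(m+3))`. -/
theorem exp_ratio_moments (m : ℕ) (hm : 2 ≤ m) :
    (∫ x : Fin m → ℝ, (∑ i, (x i) ^ 2) / (∑ i, x i) ^ 2 ∂(expPi m)) = 2 / ((m : ℝ) + 1)
    ∧
    (∫ x : Fin m → ℝ, ((∑ i, (x i) ^ 2) / (∑ i, x i) ^ 2) ^ 2 ∂(expPi m)) =
      (4 * (m : ℝ) + 20) / (((m : ℝ) + 1) * ((m : ℝ) + 2) * ((m : ℝ) + 3))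
    ∧
    (∫ x : Fin m → ℝ, ((∑ i, (x i) ^ 2) / (∑ i, x i) ^ 2) ^ 2 ∂(expPi m)) -
        (∫ x : Fin m → ℝ, (∑ i, (x i) ^ 2) / (∑ i, x i) ^ 2 ∂(expPi m)) ^ 2 =
      4 * ((m : ℝ) - 1) / (((m : ℝ) + 1) ^ 2 * ((m : ℝ) + 2) * ((m : ℝ) + 3)) := by
  obtain ⟨n, rfl⟩ : ∃ n, m = n + 1 := ⟨m - 1, by omega⟩
  rw [first, second]
  push_cast
  refine ⟨by ring_nf, by ring_nf, ?_⟩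
  have h1 : (n:ℝ) + 1 + 1 = n + 2 := by ring
  have h2 : (n:ℝ) + 1 + 2 = n + 3 := by ring
  have h3 : (n:ℝ) + 1 + 3 = n + 4 := by ring
  rw [h1, h2, h3]
  field_simp
  ring
end

section
/- Let ξ_1, ξ_2, ξ_3 be i.i.d. random variables with the exponential density e^{-x}·1_{x ≥ 0} and let Y = (ξ_1² + ξ_2² + ξ_3²)/(ξ_1 + ξ_2 + ξ_3)². Then Y takes values in [1/3, 1], and its cumulative distribution function is: P(Y ≤ t) = (2/√3)·π·(t − 1/3) for 1/3 ≤ t < 1/2, and P(Y ≤ t) = (2/√3)·[ (t − 1/3)·(π − 3·arccos(1/√(6t−2))) + (√6/2)·√(t − 1/2) ] for 1/2 ≤ t ≤ 1. Consequently Y has density f(t) = (2/√3)·π on [1/3, 1/2) and f(t) = (2/√3)·(π − 3·arccos(1/√(6t−2))) on [1/2, 1]. -/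
open MeasureTheory ProbabilityTheory Finset Real

lemma lintegral_fin_prod_aux (n : ℕ) (f : Fin n → ℝ → ENNReal) (hf : ∀ i, Measurable (f i)) :
    ∫⁻ x : Fin n → ℝ, ∏ i, f i (x i) = ∏ i, ∫⁻ x, f i x := by
  induction n with
  | zero => simp [lintegral_const, volume_pi]
  | succ n ih =>
    rw [← ((volume_preserving_piFinSuccAbove (fun _ : Fin (n+1) => ℝ) 0).symm).lintegral_comp_emb
      (MeasurableEquiv.measurableEmbedding _)]
    simp_rw [MeasurableEquiv.piFinSuccAbove_symm_apply, Fin.insertNthEquiv_apply,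
      Fin.prod_univ_succ, Fin.insertNth_zero', Fin.cons_zero, Fin.cons_succ]
    rw [← ih (fun i => f i.succ) (fun i => hf _)]
    have := hf
    have hg : Measurable (fun y : Fin n → ℝ => ∏ i, f i.succ (y i)) := by fun_prop
    exact lintegral_prod_mul (hf 0).aemeasurable hg.aemeasurable

noncomputable def nuM : Measure (Fin 3 → ℝ) :=
  volume.withDensity (fun x => ENNReal.ofReal (Real.exp (-(∑ i, x i))))

def posSet : Set (Fin 3 → ℝ) := {x | ∀ i, 0 ≤ x i}

lemma measurableSet_posSet : MeasurableSet posSet := by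
  unfold posSet
  measurability

lemma expPi_eq : expPi 3 = nuM.restrict posSet := by
  unfold expPi
  have : IsProbabilityMeasure (expMeasure 1) := isProbabilityMeasure_expMeasure one_pos
  have hm : Measurable (exponentialPDF 1) := (measurable_exponentialPDFReal 1).ennreal_ofReal
  have he : expMeasure 1 = volume.withDensity (exponentialPDF 1) := rfl
  apply Measure.pi_eq
  intro s hs
  have hS : MeasurableSet (Set.univ.pi s) := MeasurableSet.univ_pi hs
  rw [Measure.restrict_apply hS, nuM, withDensity_apply _ (hS.inter measurableSet_posSet),
    ← lintegral_indicator (hS.inter measurableSet_posSet)]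
  have : ∀ i, expMeasure 1 (s i) = ∫⁻ x, (s i).indicator (exponentialPDF 1) x := by
    intro i
    rw [he, withDensity_apply _ (hs i), lintegral_indicator (hs i)]
  simp_rw [this]
  rw [← lintegral_fin_prod_aux 3 (fun i => (s i).indicator (exponentialPDF 1))
    (fun i => hm.indicator (hs i))]
  refine lintegral_congr fun x => ?_
  by_cases h : x ∈ Set.univ.pi s ∩ posSet
  · rw [Set.indicator_of_mem h]
    have h1 : ∀ i, (s i).indicator (exponentialPDF 1) (x i) = ENNReal.ofReal (Real.exp (-(x i))) := by
      intro i
      rw [Set.indicator_of_mem (h.1 i trivial), exponentialPDF_of_nonneg (h.2 i)]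
      simp
    simp_rw [h1]
    rw [← ENNReal.ofReal_prod_of_nonneg (fun _ _ => (Real.exp_pos _).le), ← Real.exp_sum]
    simp
  · rw [Set.indicator_of_notMem h]
    symm
    rw [Finset.prod_eq_zero_iff]
    by_contra hc
    push Not at hc
    apply h
    refine ⟨fun i _ => ?_, fun i => ?_⟩
    · by_contra h2
      exact hc i (Finset.mem_univ _) (Set.indicator_of_notMem h2 _)
    · by_contra h2
      have h3 : exponentialPDF 1 (x i) = 0 := exponentialPDF_of_neg (not_le.1 h2)
      apply hc i (Finset.mem_univ _)
      by_cases h4 : x i ∈ s i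
      · rw [Set.indicator_of_mem h4, h3]
      · rw [Set.indicator_of_notMem h4]

noncomputable def phiM (p : ℝ × ℝ × ℝ) : Fin 3 → ℝ :=
  ![p.2.1, (p.1 - p.2.1) / 2 + p.2.2, (p.1 - p.2.1) / 2 - p.2.2]

lemma phiM_mp : MeasurePreserving phiM volume volume := by
  have h1 := (volume_preserving_piFinSuccAbove (fun _ : Fin 3 => ℝ) 0).symm
  have h2 := (volume_preserving_finTwoArrow ℝ).symm
  have h3 : MeasurePreserving (Prod.map (id : ℝ → ℝ) (MeasurableEquiv.finTwoArrow (α := ℝ)).symm)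
      (volume : Measure (ℝ × ℝ × ℝ)) volume := (MeasurePreserving.id volume).prod h2
  let M : Matrix (Fin 3) (Fin 3) ℝ := !![0, 1, 0; 1/2, -1/2, 1; 1/2, -1/2, -1]
  have hd : M.det = 1 := by
    simp [M, Matrix.det_fin_three]
    norm_num
  have h4 : MeasurePreserving (Matrix.toLin' M) (volume : Measure (Fin 3 → ℝ)) volume := by
    refine ⟨(LinearMap.continuous_of_finiteDimensional _).measurable, ?_⟩
    rw [Real.map_matrix_volume_pi_eq_smul_volume_pi (by rw [hd]; norm_num), hd]
    simp
  have h5 := h4.comp (h1.comp h3)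
  convert h5 using 1
  funext p
  funext i
  fin_cases i <;> simp [phiM, M, Matrix.mulVec, dotProduct, Fin.sum_univ_three,
    MeasurableEquiv.piFinSuccAbove_symm_apply]
  all_goals ring

lemma gamma_aux : ∫⁻ s in Set.Ioi (0:ℝ), ENNReal.ofReal (Real.exp (-s)) * ENNReal.ofReal (s ^ 2) = 2 := by
  have h := Real.Gamma_eq_integral (s := 3) (by norm_num)
  have hi := Real.GammaIntegral_convergent (s := 3) (by norm_num)
  have h2 : Real.Gamma 3 = 2 := by
    have := Real.Gamma_nat_eq_factorial 2
    rw [show ((2:ℕ):ℝ) + 1 = 3 by norm_num] at this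
    rw [this]
    norm_num [Nat.factorial]
  rw [h2] at h
  have h3 := ofReal_integral_eq_lintegral_ofReal hi (by
    refine (ae_restrict_iff' measurableSet_Ioi).2 (Filter.Eventually.of_forall fun x hx => ?_)
    have : (0:ℝ) < x := hx
    simp only [Pi.zero_apply]
    positivity)
  rw [← h] at h3
  rw [show (2:ENNReal) = ENNReal.ofReal 2 by simp, h3]
  refine setLIntegral_congr_fun measurableSet_Ioi fun x hx => ?_
  rw [← ENNReal.ofReal_mul (Real.exp_pos _).le]
  congr 2
  norm_num

def coneSet (K : Set (ℝ × ℝ)) : Set (Fin 3 → ℝ) :=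
  {x | 0 < ∑ i, x i ∧ (x 0 / ∑ i, x i, (x 1 - x 2) / (2 * ∑ i, x i)) ∈ K}

lemma measurableSet_coneSet {K : Set (ℝ × ℝ)} (hK : MeasurableSet K) :
    MeasurableSet (coneSet K) := by
  unfold coneSet
  apply MeasurableSet.inter
  · exact measurableSet_lt measurable_const
      (show Measurable (fun x : Fin 3 → ℝ => ∑ i, x i) by fun_prop)
  · exact (show Measurable (fun x : Fin 3 → ℝ => (x 0 / ∑ i, x i, (x 1 - x 2) / (2 * ∑ i, x i))) by
      fun_prop) hK

lemma nu_cone {K : Set (ℝ × ℝ)} (hK : MeasurableSet K) : nuM (coneSet K) = 2 * volume K := by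
  have hC := measurableSet_coneSet hK
  have hme : Measurable (fun x : Fin 3 → ℝ => ENNReal.ofReal (Real.exp (-(∑ i, x i)))) := by fun_prop
  rw [nuM, withDensity_apply _ hC, ← lintegral_indicator hC,
    ← phiM_mp.lintegral_comp (hme.indicator hC), Measure.volume_eq_prod]
  have hcomp : Measurable (fun a => (coneSet K).indicator
      (fun x => ENNReal.ofReal (rexp (-∑ i, x i))) (phiM a)) :=
    (hme.indicator hC).comp phiM_mp.measurable
  rw [lintegral_prod _ hcomp.aemeasurable, ← gamma_aux,
     ← lintegral_mul_const _ (by fun_prop), ← lintegral_indicator measurableSet_Ioi]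
  refine lintegral_congr fun s => ?_
  have hs : ∀ q : ℝ × ℝ, ∑ i, phiM (s, q) i = s := by
    intro q
    simp [phiM, Fin.sum_univ_three]
    ring
  by_cases h : 0 < s
  · rw [Set.indicator_of_mem (show s ∈ Set.Ioi 0 from h)]
    have hset : ∀ q : ℝ × ℝ, phiM (s, q) ∈ coneSet K ↔ q ∈ (fun q => s⁻¹ • q) ⁻¹' K := by
      intro q
      unfold coneSet
      rw [Set.mem_ofPred_eq, hs]
      have : (phiM (s, q) 0 / s, (phiM (s, q) 1 - phiM (s, q) 2) / (2 * s)) = s⁻¹ • q := by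
        ext
        · simp [phiM]; field_simp
        · simp [phiM]; field_simp; ring
      rw [this]
      simp [h]
    have hK2 : MeasurableSet ((fun q : ℝ × ℝ => s⁻¹ • q) ⁻¹' K) :=
      (measurable_const_smul s⁻¹) hK
    have : ∀ q : ℝ × ℝ, (coneSet K).indicator (fun x : Fin 3 → ℝ => ENNReal.ofReal (Real.exp (-(∑ i, x i)))) (phiM (s, q))
       = ((fun q => s⁻¹ • q) ⁻¹' K).indicator (fun _ => ENNReal.ofReal (Real.exp (-s))) q := by
      intro q
      by_cases hq : phiM (s, q) ∈ coneSet K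
      · rw [Set.indicator_of_mem hq, Set.indicator_of_mem ((hset q).1 hq), hs]
      · rw [Set.indicator_of_notMem hq, Set.indicator_of_notMem (fun h => hq ((hset q).2 h))]
    simp_rw [this]
    rw [lintegral_indicator hK2, setLIntegral_const, Measure.addHaar_preimage_smul _ (by positivity)]
    simp only [Module.finrank_prod, Module.finrank_self]
    rw [mul_assoc]
    congr 3
    rw [abs_of_pos (by positivity)]
    simp
  · rw [Set.indicator_of_notMem (show s ∉ Set.Ioi 0 from h)]
    have : ∀ q : ℝ × ℝ, (coneSet K).indicator (fun x : Fin 3 → ℝ => ENNReal.ofReal (Real.exp (-(∑ i, x i)))) (phiM (s, q))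
       = 0 := by
      intro q
      apply Set.indicator_of_notMem
      intro hc
      apply h
      have := hc.1
      rwa [hs] at this
    simp [this]

def Kt (t : ℝ) (B : Set ℝ) : Set (ℝ × ℝ) :=
  {q | q.1 ^ 2 + (1 - q.1) ^ 2 / 2 + 2 * q.2 ^ 2 ≤ t ∧ q.1 ∈ B}

lemma measurableSet_Kt (t : ℝ) {B : Set ℝ} (hB : MeasurableSet B) : MeasurableSet (Kt t B) := by
  unfold Kt
  apply MeasurableSet.inter
  · exact measurableSet_le (show Measurable (fun q : ℝ × ℝ =>
      q.1 ^ 2 + (1 - q.1) ^ 2 / 2 + 2 * q.2 ^ 2) by fun_prop) measurable_const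
  · exact measurable_fst hB

lemma mem_cone_Kt (t : ℝ) (B : Set ℝ) (x : Fin 3 → ℝ) :
    x ∈ coneSet (Kt t B) ↔ 0 < ∑ i, x i ∧ ∑ i, x i ^ 2 ≤ t * (∑ i, x i) ^ 2 ∧
      x 0 / (∑ i, x i) ∈ B := by
  unfold coneSet Kt
  simp only [Set.mem_ofPred_eq]
  refine and_congr_right fun hs => and_congr_left fun _ => ?_
  have : (x 0 / ∑ i, x i) ^ 2 + (1 - x 0 / ∑ i, x i) ^ 2 / 2
      + 2 * ((x 1 - x 2) / (2 * ∑ i, x i)) ^ 2 = (∑ i, x i ^ 2) / (∑ i, x i) ^ 2 := by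
    simp only [Fin.sum_univ_three] at hs ⊢
    field_simp
    ring
  rw [this, div_le_iff₀ (by positivity)]

noncomputable def Gf (R u : ℝ) : ℝ := (u * √(R ^ 2 - u ^ 2) + R ^ 2 * Real.arcsin (u / R)) / 2

lemma Gf_deriv {R u : ℝ} (h1 : -R < u) (h2 : u < R) :
    HasDerivAt (Gf R) (√(R ^ 2 - u ^ 2)) u := by
  have hR : 0 < R := by linarith
  have hp : 0 < R ^ 2 - u ^ 2 := by nlinarith
  have hq : √(1 - (u / R) ^ 2) = √(R ^ 2 - u ^ 2) / R := by
    rw [show 1 - (u / R) ^ 2 = (R ^ 2 - u ^ 2) / R ^ 2 by field_simp, Real.sqrt_div hp.le,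
      Real.sqrt_sq hR.le]
  have hs := Real.sqrt_pos.2 hp
  have hs2 := Real.sq_sqrt hp.le
  have e1 : HasDerivAt (fun u : ℝ => R ^ 2 - u ^ 2) (-(2 * u)) u := by
    simpa using ((hasDerivAt_pow 2 u).const_sub (R ^ 2))
  have e2 := e1.sqrt hp.ne'
  have e3 := (hasDerivAt_id u).mul e2
  have e4 : HasDerivAt (fun u : ℝ => u / R) (1 / R) u := (hasDerivAt_id u).div_const R
  have e5 : HasDerivAt (fun u : ℝ => Real.arcsin (u / R)) (1 / √(1 - (u / R) ^ 2) * (1 / R)) u :=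
    HasDerivAt.comp (h₂ := Real.arcsin) u (Real.hasDerivAt_arcsin (x := u / R)
      (by rw [Ne, div_eq_iff hR.ne']; linarith)
      (by rw [Ne, div_eq_iff hR.ne']; linarith)) e4
  have e6 := (e3.add (e5.const_mul (R ^ 2))).div_const 2
  refine HasDerivAt.congr_deriv (f := Gf R) e6 ?_
  rw [hq]
  simp only [id]
  field_simp
  nlinarith

lemma Gf_cont (R : ℝ) : Continuous (Gf R) := by
  unfold Gf
  have := Real.continuous_arcsin
  fun_prop

noncomputable def wf (R a : ℝ) : ℝ := √3 * √(R ^ 2 - (a - 1 / 3) ^ 2)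

lemma wf_cont (R : ℝ) : Continuous (wf R) := by unfold wf; fun_prop

lemma vol_Kt {t R : ℝ} (hR : R ^ 2 = 2 / 3 * (t - 1 / 3)) {B : Set ℝ} (hB : MeasurableSet B) :
    volume (Kt t B) = ∫⁻ a in B, ENNReal.ofReal (wf R a) := by
  rw [Measure.volume_eq_prod, Measure.prod_apply (measurableSet_Kt t hB), ← lintegral_indicator hB]
  refine lintegral_congr fun a => ?_
  by_cases ha : a ∈ B
  · rw [Set.indicator_of_mem ha]
    have hX : 3 / 4 * (R ^ 2 - (a - 1 / 3) ^ 2) = (t - a ^ 2 - (1 - a) ^ 2 / 2) / 2 := by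
      rw [hR]; ring
    have hw : wf R a = 2 * √((t - a ^ 2 - (1 - a) ^ 2 / 2) / 2) := by
      rw [← hX, Real.sqrt_mul (by norm_num), Real.sqrt_div (by norm_num), wf,
        show (4:ℝ) = 2 ^ 2 by norm_num, Real.sqrt_sq (by norm_num)]
      ring
    rw [hw]
    set X := (t - a ^ 2 - (1 - a) ^ 2 / 2) / 2 with hXd
    have hmem : ∀ w, w ∈ Prod.mk a ⁻¹' Kt t B ↔ w ^ 2 ≤ X := by
      intro w
      simp only [Kt, Set.mem_preimage, Set.mem_ofPred_eq, ha, and_true, hXd]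
      constructor <;> intro h <;> linarith
    by_cases hX0 : 0 ≤ X
    · have : Prod.mk a ⁻¹' Kt t B = Set.Icc (-√X) (√X) := by
        ext w
        rw [hmem, Set.mem_Icc, ← abs_le, ← Real.sqrt_sq_eq_abs]
        exact (Real.sqrt_le_sqrt_iff hX0).symm
      rw [this, Real.volume_Icc]
      congr 1; ring
    · have : Prod.mk a ⁻¹' Kt t B = ∅ := by
        ext w
        rw [hmem]
        simp only [Set.mem_empty_iff_false, iff_false]
        nlinarith [sq_nonneg w]
      rw [this, Real.sqrt_eq_zero_of_nonpos (not_le.1 hX0).le]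
      simp
  · rw [Set.indicator_of_notMem ha]
    have : Prod.mk a ⁻¹' Kt t B = ∅ := by
      ext w
      simp [Kt, ha]
    simp [this]

lemma wf_zero {R a : ℝ} (hR : 0 ≤ R) (h : a ∉ Set.Ioc (1 / 3 - R) (1 / 3 + R)) : wf R a = 0 := by
  unfold wf
  refine mul_eq_zero_of_right _ (Real.sqrt_eq_zero_of_nonpos ?_)
  rw [Set.mem_Ioc, not_and_or, not_lt, not_le] at h
  rcases h with h | h <;> nlinarith

lemma int_wf {R m : ℝ} (hR : 0 ≤ R) (h1 : 1 / 3 - R ≤ m) (h2 : m ≤ 1 / 3 + R) :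
    ∫⁻ a in Set.Ioc (1 / 3 - R) m, ENNReal.ofReal (wf R a) =
      ENNReal.ofReal (√3 * (Gf R (m - 1 / 3) - Gf R (-R))) := by
  have hc := wf_cont R
  have hi : IntervalIntegrable (wf R) volume (1 / 3 - R) m := hc.intervalIntegrable _ _
  rw [← ofReal_integral_eq_lintegral_ofReal ((intervalIntegrable_iff_integrableOn_Ioc_of_le h1).1 hi)
    (Filter.Eventually.of_forall fun a => by simp only [Pi.zero_apply]; unfold wf; positivity)]
  rw [← intervalIntegral.integral_of_le h1]
  rw [intervalIntegral.integral_eq_sub_of_hasDerivAt_of_le (f := fun a => √3 * Gf R (a - 1 / 3)) h1 ?_ ?_ hi]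
  · congr 1
    rw [show 1 / 3 - R - 1 / 3 = -R by ring]
    ring
  · have := Gf_cont R
    fun_prop
  · intro a ha
    have e := Gf_deriv (R := R) (u := a - 1 / 3) (by linarith [ha.1]) (by linarith [ha.2])
    exact (e.comp_sub_const a (1 / 3)).const_mul (√3)

lemma int_wf_sub {R : ℝ} (hR : 0 ≤ R) {B : Set ℝ} (hB : MeasurableSet B) :
    ∫⁻ a in B, ENNReal.ofReal (wf R a) =
      ∫⁻ a in B ∩ Set.Ioc (1 / 3 - R) (1 / 3 + R), ENNReal.ofReal (wf R a) := by
  rw [← lintegral_indicator hB, ← lintegral_indicator (hB.inter measurableSet_Ioc)]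
  refine lintegral_congr fun a => ?_
  rw [← Set.indicator_indicator]
  by_cases ha : a ∈ B
  · simp only [Set.indicator_of_mem ha]
    by_cases h : a ∈ Set.Ioc (1 / 3 - R) (1 / 3 + R)
    · rw [Set.indicator_of_mem h]
    · rw [Set.indicator_of_notMem h, wf_zero hR h]; simp
  · simp only [Set.indicator_of_notMem ha]

lemma Gf_neg_self (R : ℝ) (hR : 0 ≤ R) : Gf R (-R) = - (R ^ 2 * π) / 4 := by
  unfold Gf
  rcases hR.eq_or_lt with h | h
  · subst h; simp
  · rw [neg_div, div_self h.ne']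
    simp
    ring

lemma Gf_self (R : ℝ) (hR : 0 ≤ R) : Gf R R = (R ^ 2 * π) / 4 := by
  unfold Gf
  rcases hR.eq_or_lt with h | h
  · subst h; simp
  · rw [div_self h.ne']
    simp
    ring

lemma vol_Kt_univ {t : ℝ} (ht : 1 / 3 ≤ t) :
    volume (Kt t Set.univ) = ENNReal.ofReal (√3 * (π / 3 * (t - 1 / 3))) := by
  obtain ⟨R, hR0, hR⟩ : ∃ R : ℝ, 0 ≤ R ∧ R ^ 2 = 2 / 3 * (t - 1 / 3) :=
    ⟨√(2 / 3 * (t - 1 / 3)), Real.sqrt_nonneg _, Real.sq_sqrt (by linarith)⟩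
  rw [vol_Kt hR MeasurableSet.univ, int_wf_sub hR0 MeasurableSet.univ, Set.univ_inter,
    int_wf hR0 (by linarith) le_rfl, Gf_neg_self R hR0, show 1 / 3 + R - 1 / 3 = R by ring,
    Gf_self R hR0, hR]
  congr 1
  ring

lemma vol_Kt_small {t : ℝ} (ht : t < 1 / 2) : volume (Kt t (Set.Iio 0)) = 0 := by
  have : Kt t (Set.Iio 0) = ∅ := by
    ext q
    simp only [Kt, Set.mem_ofPred_eq, Set.mem_Iio, Set.mem_empty_iff_false, iff_false, not_and, not_lt]
    intro h
    nlinarith [sq_nonneg q.2, sq_nonneg q.1]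
  simp [this]

lemma Gf_mono {R u : ℝ} (h1 : -R ≤ u) (h2 : u ≤ R) : Gf R (-R) ≤ Gf R u := by
  have : MonotoneOn (Gf R) (Set.Icc (-R) R) := by
    refine monotoneOn_of_deriv_nonneg (convex_Icc _ _) (Gf_cont R).continuousOn ?_ ?_
    · rw [interior_Icc]
      intro x hx
      exact (Gf_deriv hx.1 hx.2).differentiableAt.differentiableWithinAt
    · rw [interior_Icc]
      intro x hx
      rw [(Gf_deriv hx.1 hx.2).deriv]
      positivity
  exact this ⟨le_rfl, h1.trans h2⟩ ⟨h1, h2⟩ h1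

lemma seg_aux {t : ℝ} (ht : 1 / 2 ≤ t) :
    0 ≤ (√3 / 3 * ((t - 1 / 3) * Real.arccos (1 / √(6 * t - 2)) - √6 / 6 * √(t - 1 / 2))) ∧
    volume (Kt t (Set.Iio 0)) = ENNReal.ofReal (√3 / 3 * ((t - 1 / 3) * Real.arccos (1 / √(6 * t - 2))
      - √6 / 6 * √(t - 1 / 2))) := by
  obtain ⟨R, hR0, hR⟩ : ∃ R : ℝ, 0 ≤ R ∧ R ^ 2 = 2 / 3 * (t - 1 / 3) :=
    ⟨√(2 / 3 * (t - 1 / 3)), Real.sqrt_nonneg _, Real.sq_sqrt (by linarith)⟩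
  have hR3 : 1 / 3 ≤ R := by nlinarith
  have h6 : √(6 * t - 2) = 3 * R := by
    rw [Real.sqrt_eq_iff_mul_self_eq (by linarith) (by linarith)]
    nlinarith
  have hB : Set.Iio (0:ℝ) ∩ Set.Ioc (1 / 3 - R) (1 / 3 + R) = Set.Ioo (1 / 3 - R) 0 := by
    ext a
    simp only [Set.mem_inter_iff, Set.mem_Iio, Set.mem_Ioc, Set.mem_Ioo]
    constructor
    · rintro ⟨h1, h2, h3⟩; exact ⟨h2, h1⟩
    · rintro ⟨h1, h2⟩; exact ⟨h2, h1, by linarith⟩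
  rw [vol_Kt hR measurableSet_Iio, int_wf_sub hR0 measurableSet_Iio, hB,
    setLIntegral_congr Ioo_ae_eq_Ioc,
    int_wf hR0 (by linarith) (by linarith), Gf_neg_self R hR0, h6, Real.arccos]
  suffices hfact : √3 * (Gf R (0 - 1 / 3) - -(R ^ 2 * π) / 4) = (√3 / 3 * ((t - 1 / 3) * (π / 2 - Real.arcsin (1 / (3 * R)))
      - √6 / 6 * √(t - 1 / 2))) by
    rw [← hfact]
    refine ⟨?_, rfl⟩
    rw [← Gf_neg_self R hR0]
    exact mul_nonneg (by positivity) (sub_nonneg.2 (Gf_mono (by linarith) (by linarith)))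
  unfold Gf
  have e1 : (0 - 1 / 3) / R = - (1 / (3 * R)) := by
    field_simp; norm_num
  have e2 : √(R ^ 2 - (0 - 1 / 3) ^ 2) = √6 / 3 * √(t - 1 / 2) := by
    have h0 : (0:ℝ) ≤ t - 1 / 2 := by linarith
    rw [Real.sqrt_eq_iff_mul_self_eq (by nlinarith) (by positivity)]
    have := Real.sq_sqrt h0
    have h6 := Real.sq_sqrt (show (0:ℝ) ≤ 6 by norm_num)
    calc _ = √6 ^ 2 / 9 * √(t - 1 / 2) ^ 2 := by rw [this, h6, hR]; ring
      _ = _ := by ring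
  rw [e1, e2, Real.arcsin_neg, hR]
  ring

lemma seg_nonneg {t : ℝ} (ht : 1 / 2 ≤ t) :
    0 ≤ (√3 / 3 * ((t - 1 / 3) * Real.arccos (1 / √(6 * t - 2)) - √6 / 6 * √(t - 1 / 2))) :=
  (seg_aux ht).1

lemma vol_Kt_seg {t : ℝ} (ht : 1 / 2 ≤ t) :
    volume (Kt t (Set.Iio 0)) = ENNReal.ofReal (√3 / 3 * ((t - 1 / 3) * Real.arccos (1 / √(6 * t - 2))
      - √6 / 6 * √(t - 1 / 2))) := (seg_aux ht).2

def Di (t : ℝ) (i : Fin 3) : Set (Fin 3 → ℝ) :=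
  {x | 0 < ∑ i, x i ∧ ∑ i, x i ^ 2 ≤ t * (∑ i, x i) ^ 2 ∧ x i < 0}

def Dp (t : ℝ) : Set (Fin 3 → ℝ) :=
  {x | 0 < ∑ i, x i ∧ ∑ i, x i ^ 2 ≤ t * (∑ i, x i) ^ 2 ∧ ∀ i, 0 ≤ x i}

lemma Di_zero (t : ℝ) : Di t 0 = coneSet (Kt t (Set.Iio 0)) := by
  ext x
  rw [mem_cone_Kt, Di]
  simp only [Set.mem_ofPred_eq, Set.mem_Iio]
  refine and_congr_right fun hs => and_congr_right fun _ => ?_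
  rw [div_lt_iff₀ hs, zero_mul]

lemma measurableSet_Di (t : ℝ) (i : Fin 3) : MeasurableSet (Di t i) := by
  have h1 : Measurable (fun x : Fin 3 → ℝ => ∑ i, x i) := by fun_prop
  have h2 : Measurable (fun x : Fin 3 → ℝ => ∑ i, x i ^ 2) := by fun_prop
  exact (measurableSet_lt measurable_const h1).inter
    ((measurableSet_le h2 ((h1.pow_const 2).const_mul t)).inter
      (measurableSet_lt (measurable_pi_apply i) measurable_const))

lemma nu_Di (t : ℝ) (i : Fin 3) : nuM (Di t i) = 2 * volume (Kt t (Set.Iio 0)) := by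
  rw [← nu_cone (measurableSet_Kt t measurableSet_Iio), ← Di_zero]
  have hme : Measurable (fun x : Fin 3 → ℝ => ENNReal.ofReal (Real.exp (-(∑ i, x i)))) := by fun_prop
  have hmp := volume_measurePreserving_piCongrLeft (fun _ : Fin 3 => ℝ) (Equiv.swap 0 i)
  have hval : ∀ (x : Fin 3 → ℝ) j, MeasurableEquiv.piCongrLeft (fun _ : Fin 3 => ℝ) (Equiv.swap 0 i) x j
      = x (Equiv.swap 0 i j) := by
    intro x j
    have := MeasurableEquiv.piCongrLeft_apply_apply (β := fun _ => ℝ) (Equiv.swap 0 i) x (Equiv.swap 0 i j)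
    rwa [Equiv.swap_apply_self] at this
  rw [nuM, withDensity_apply _ (measurableSet_Di t i), withDensity_apply _ (measurableSet_Di t 0),
    ← lintegral_indicator (measurableSet_Di t i), ← lintegral_indicator (measurableSet_Di t 0),
    ← hmp.lintegral_comp (hme.indicator (measurableSet_Di t i))]
  refine lintegral_congr fun x => ?_
  have hs : ∑ j, MeasurableEquiv.piCongrLeft (fun _ : Fin 3 => ℝ) (Equiv.swap 0 i) x j = ∑ j, x j := by
    simp_rw [hval]
    exact Equiv.sum_comp (Equiv.swap 0 i) x
  have hq : ∑ j, (MeasurableEquiv.piCongrLeft (fun _ : Fin 3 => ℝ) (Equiv.swap 0 i) x j) ^ 2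
      = ∑ j, x j ^ 2 := by
    simp_rw [hval]
    exact Equiv.sum_comp (Equiv.swap 0 i) (fun j => x j ^ 2)
  have hm : MeasurableEquiv.piCongrLeft (fun _ : Fin 3 => ℝ) (Equiv.swap 0 i) x ∈ Di t i ↔ x ∈ Di t 0 := by
    unfold Di
    rw [Set.mem_ofPred_eq, Set.mem_ofPred_eq, hs, hq, hval, Equiv.swap_apply_right]
  by_cases h : x ∈ Di t 0
  · rw [Set.indicator_of_mem h, Set.indicator_of_mem (hm.2 h), hs]
  · rw [Set.indicator_of_notMem h, Set.indicator_of_notMem (fun h' => h (hm.1 h'))]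

lemma Di_disj {t : ℝ} (ht : t ≤ 1) {x : Fin 3 → ℝ} {i j : Fin 3} (hij : i ≠ j)
    (hi : x ∈ Di t i) (hj : x ∈ Di t j) : False := by
  obtain ⟨h1, h2, h3⟩ := hi
  obtain ⟨-, -, h4⟩ := hj
  have h5 : ∑ i, x i ^ 2 ≤ (∑ i, x i) ^ 2 :=
    h2.trans (by nlinarith [sq_nonneg (∑ i, x i)])
  simp only [Fin.sum_univ_three] at h1 h5
  fin_cases i <;> fin_cases j <;> simp at hij h3 h4 <;>
    nlinarith [mul_pos_of_neg_of_neg h3 h4, sq_nonneg (x 0), sq_nonneg (x 1), sq_nonneg (x 2)]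

lemma nu_Dp {t : ℝ} (ht : t ≤ 1) :
    nuM (Dp t) + 6 * volume (Kt t (Set.Iio 0)) = 2 * volume (Kt t Set.univ) := by
  have hU : coneSet (Kt t Set.univ) = Dp t ∪ ⋃ i, Di t i := by
    ext x
    rw [mem_cone_Kt]
    simp only [Dp, Di, Set.mem_univ, and_true, Set.mem_union, Set.mem_iUnion, Set.mem_ofPred_eq]
    constructor
    · rintro ⟨h1, h2⟩
      by_cases h : ∀ i, 0 ≤ x i
      · exact Or.inl ⟨h1, h2, h⟩
      · push Not at h
        obtain ⟨i, hi⟩ := h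
        exact Or.inr ⟨i, h1, h2, hi⟩
    · rintro (⟨h1, h2, _⟩ | ⟨i, h1, h2, _⟩) <;> exact ⟨h1, h2⟩
  have hd : Disjoint (Dp t) (⋃ i, Di t i) := by
    rw [Set.disjoint_left]
    intro x hx hx2
    obtain ⟨i, hi⟩ := Set.mem_iUnion.1 hx2
    exact absurd hi.2.2 (not_lt.2 (hx.2.2 i))
  rw [← nu_cone (measurableSet_Kt t MeasurableSet.univ), hU,
    measure_union hd (MeasurableSet.iUnion fun i => measurableSet_Di t i),
    measure_iUnion (fun i j hij => Set.disjoint_left.2 fun x => Di_disj ht hij)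
      (fun i => measurableSet_Di t i)]
  simp_rw [nu_Di]
  rw [tsum_fintype, Finset.sum_const, Finset.card_univ, Fintype.card_fin]
  congr 1
  rw [nsmul_eq_mul, ← mul_assoc]
  norm_num

lemma nu_zero : nuM {(0 : Fin 3 → ℝ)} = 0 := by
  apply withDensity_absolutelyContinuous
  exact measure_singleton _

lemma measurable_Y : Measurable (fun x : Fin 3 → ℝ => (∑ i, (x i) ^ 2) / (∑ i, x i) ^ 2) := by
  fun_prop

lemma expPi_le_eq {t : ℝ} (ht : 0 ≤ t) :
    expPi 3 {x | (∑ i, (x i) ^ 2) / (∑ i, x i) ^ 2 ≤ t} = nuM (Dp t) := by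
  have hm : MeasurableSet {x : Fin 3 → ℝ | (∑ i, (x i) ^ 2) / (∑ i, x i) ^ 2 ≤ t} :=
    measurableSet_le measurable_Y measurable_const
  rw [expPi_eq, Measure.restrict_apply hm]
  apply le_antisymm
  · calc _ ≤ nuM (Dp t ∪ {0}) := by
          apply measure_mono
          rintro x ⟨h1, h2⟩
          have hs : 0 ≤ ∑ i, x i := Finset.sum_nonneg fun i _ => h2 i
          rcases hs.eq_or_lt with h | h
          · right
            rw [eq_comm, Finset.sum_eq_zero_iff_of_nonneg (fun i _ => h2 i)] at h
            ext i
            exact h i (Finset.mem_univ _)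
          · left
            refine ⟨h, ?_, h2⟩
            rwa [Set.mem_ofPred_eq, div_le_iff₀ (by positivity)] at h1
      _ ≤ nuM (Dp t) + nuM {0} := measure_union_le _ _
      _ = _ := by rw [nu_zero, add_zero]
  · apply measure_mono
    rintro x ⟨h1, h2, h3⟩
    refine ⟨?_, h3⟩
    rwa [Set.mem_ofPred_eq, div_le_iff₀ (by positivity)]

lemma ae_Y : ∀ᵐ x ∂(expPi 3), (∑ i, (x i) ^ 2) / (∑ i, x i) ^ 2 ∈ Set.Icc (1 / 3 : ℝ) 1 := by
  rw [expPi_eq, ae_restrict_iff' measurableSet_posSet]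
  have h0 : ∀ᵐ x ∂nuM, x ≠ 0 := by
    rw [ae_iff]
    simpa using nu_zero
  filter_upwards [h0] with x hx hp
  have hs : 0 ≤ ∑ i, x i := Finset.sum_nonneg fun i _ => hp i
  have hs' : 0 < ∑ i, x i := by
    rcases hs.eq_or_lt with h | h
    · exfalso
      apply hx
      rw [eq_comm, Finset.sum_eq_zero_iff_of_nonneg (fun i _ => hp i)] at h
      ext i
      exact h i (Finset.mem_univ _)
    · exact h
  rw [Set.mem_Icc, le_div_iff₀ (by positivity), div_le_one (by positivity)]
  have a0 := hp 0
  have a1 := hp 1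
  have a2 := hp 2
  simp only [Fin.sum_univ_three]
  constructor
  · nlinarith [sq_nonneg (x 0 - x 1), sq_nonneg (x 0 - x 2), sq_nonneg (x 1 - x 2)]
  · nlinarith [mul_nonneg a0 a1, mul_nonneg a0 a2, mul_nonneg a1 a2]

lemma cdf_small (t : ℝ) (h1 : 1 / 3 ≤ t) (h2 : t < 1 / 2) :
      (expPi 3) {x | (∑ i, (x i) ^ 2) / (∑ i, x i) ^ 2 ≤ t} =
        ENNReal.ofReal (2 / Real.sqrt 3 * π * (t - 1 / 3)) := by
  rw [expPi_le_eq (by linarith)]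
  have h := nu_Dp (t := t) (by linarith)
  rw [vol_Kt_small h2, mul_zero, add_zero, vol_Kt_univ h1] at h
  rw [h, show (2:ENNReal) = ENNReal.ofReal 2 by simp, ← ENNReal.ofReal_mul (by norm_num)]
  congr 1
  have h3 : √3 ^ 2 = 3 := Real.sq_sqrt (by norm_num)
  have : 0 < √3 := by positivity
  field_simp
  rw [h3]

noncomputable def Fl (t : ℝ) : ℝ := (t - 1 / 3) * (π - 3 * Real.arccos (1 / Real.sqrt (6 * t - 2))) +
            Real.sqrt 6 / 2 * Real.sqrt (t - 1 / 2)

lemma cdf_large (t : ℝ) (h1 : 1 / 2 ≤ t) (h2 : t ≤ 1) :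
      (expPi 3) {x | (∑ i, (x i) ^ 2) / (∑ i, x i) ^ 2 ≤ t} =
        ENNReal.ofReal (2 / Real.sqrt 3 * Fl t) := by
  rw [expPi_le_eq (by linarith)]
  have h := nu_Dp (t := t) (by linarith)
  rw [vol_Kt_univ (by linarith)] at h
  have hseg := vol_Kt_seg h1
  have hfin : 6 * volume (Kt t (Set.Iio 0)) ≠ ⊤ := by
    rw [hseg]; exact ENNReal.mul_ne_top (by norm_num) ENNReal.ofReal_ne_top
  rw [ENNReal.eq_sub_of_add_eq hfin h, hseg, show (2:ENNReal) = ENNReal.ofReal 2 by simp,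
    show (6:ENNReal) = ENNReal.ofReal 6 by simp, ← ENNReal.ofReal_mul (by norm_num),
    ← ENNReal.ofReal_mul (by norm_num), ← ENNReal.ofReal_sub]
  · congr 1
    have h3 : √3 ^ 2 = 3 := Real.sq_sqrt (by norm_num)
    have : 0 < √3 := by positivity
    unfold Fl
    field_simp
    rw [h3]
    ring
  · exact mul_nonneg (by norm_num) (seg_nonneg h1)

lemma arg_eq {t : ℝ} (ht : 1 / 2 < t) :
    HasDerivAt Fl (π - 3 * Real.arccos (1 / √(6 * t - 2))) t := by
  have hg : 0 < 6 * t - 2 := by linarith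
  have hh : 0 < t - 1 / 2 := by linarith
  have hsg : 0 < √(6 * t - 2) := Real.sqrt_pos.2 hg
  have hsh : 0 < √(t - 1 / 2) := Real.sqrt_pos.2 hh
  have hs6 : 0 < √6 := Real.sqrt_pos.2 (by norm_num)
  have hsg2 := Real.sq_sqrt hg.le
  have hsh2 := Real.sq_sqrt hh.le
  have hs62 := Real.sq_sqrt (show (0:ℝ) ≤ 6 by norm_num)
  have e1 : HasDerivAt (fun t : ℝ => 6 * t - 2) 6 t := by
    simpa using ((hasDerivAt_id t).const_mul 6).sub_const 2
  have e2 := e1.sqrt hg.ne'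
  have e3 : HasDerivAt (fun t : ℝ => 1 / √(6 * t - 2)) (-(6 / (2 * √(6 * t - 2))) / √(6 * t - 2) ^ 2) t := by
    simp only [one_div]
    exact e2.inv hsg.ne'
  have hc1 : 1 / √(6 * t - 2) < 1 := by
    rw [div_lt_one hsg]
    exact Real.lt_sqrt_of_sq_lt (by linarith)
  have hc0 : 0 < 1 / √(6 * t - 2) := by positivity
  have hq : √(1 - (1 / √(6 * t - 2)) ^ 2) = √6 * √(t - 1 / 2) / √(6 * t - 2) := by
    rw [Real.sqrt_eq_iff_mul_self_eq (by nlinarith) (by positivity)]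
    have : √6 * √(t - 1 / 2) / √(6 * t - 2) * (√6 * √(t - 1 / 2) / √(6 * t - 2))
       = √6 ^ 2 * √(t - 1 / 2) ^ 2 / √(6 * t - 2) ^ 2 := by field_simp
    rw [this, div_pow, hs62, hsh2, hsg2]
    field_simp
    ring
  have e4 : HasDerivAt (fun t : ℝ => Real.arccos (1 / √(6 * t - 2))) _ t :=
    HasDerivAt.comp (h₂ := Real.arccos) t
    (Real.hasDerivAt_arccos (x := 1 / √(6 * t - 2)) (by linarith) (by linarith)) e3
  have e5 : HasDerivAt (fun t : ℝ => √(t - 1 / 2)) (1 / (2 * √(t - 1 / 2))) t :=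
    ((hasDerivAt_id t).sub_const (1 / 2)).sqrt hh.ne'
  have e6 := (((hasDerivAt_id t).sub_const (1 / 3)).mul ((e4.const_mul 3).const_sub π)).add
    (e5.const_mul (√6 / 2))
  refine HasDerivAt.congr_deriv (f := Fl) e6 ?_
  rw [hq]
  have hx : (t - 1 / 3) = √(6 * t - 2) ^ 2 / 6 := by rw [hsg2]; ring
  simp only [id]
  rw [hx]
  generalize Real.arccos (1 / √(6 * t - 2)) = A
  field_simp
  rw [hs62]
  ring

lemma argcont : ContinuousOn (fun t : ℝ => 1 / √(6 * t - 2)) (Set.Ici (1 / 2)) := by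
  refine ContinuousOn.div continuousOn_const (by fun_prop) fun t ht => ?_
  have : (1:ℝ) / 2 ≤ t := ht
  exact (Real.sqrt_pos.2 (by linarith)).ne'

lemma fcont : ContinuousOn (fun t : ℝ => π - 3 * Real.arccos (1 / √(6 * t - 2))) (Set.Ici (1 / 2)) :=
  continuousOn_const.sub (continuousOn_const.mul (Real.continuous_arccos.comp_continuousOn argcont))

lemma Fl_cont : ContinuousOn Fl (Set.Ici (1 / 2)) := by
  unfold Fl
  exact ((continuousOn_id.sub continuousOn_const).mul fcont).add (by fun_prop)

lemma f_nonneg {t : ℝ} (h1 : 1 / 2 ≤ t) (h2 : t ≤ 1) :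
    0 ≤ π - 3 * Real.arccos (1 / √(6 * t - 2)) := by
  have hg : 0 < √(6 * t - 2) := Real.sqrt_pos.2 (by linarith)
  have h : √(6 * t - 2) ≤ 2 := by
    rw [Real.sqrt_le_left (by norm_num)]; linarith
  have h3 : (1:ℝ) / 2 ≤ 1 / √(6 * t - 2) := one_div_le_one_div_of_le hg h
  have h4 : Real.arccos (1 / 2) = π / 3 := by
    rw [← Real.cos_pi_div_three, Real.arccos_cos] <;> linarith [Real.pi_pos]
  have := Real.arccos_le_arccos h3
  rw [h4] at this
  linarith

lemma Fl_half : Fl (1 / 2) = π / 6 := by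
  unfold Fl
  norm_num
  ring

noncomputable def ff (t : ℝ) : ℝ := if t < 1 / 2 then 2 / Real.sqrt 3 * π
          else 2 / Real.sqrt 3 * (π - 3 * Real.arccos (1 / Real.sqrt (6 * t - 2)))

lemma int_large {a : ℝ} (h1 : 1 / 2 ≤ a) (h2 : a ≤ 1) :
    ∫⁻ t in Set.Ioc (1 / 2) a, ENNReal.ofReal (ff t) = ENNReal.ofReal (2 / √3 * (Fl a - Fl (1 / 2))) ∧
      0 ≤ 2 / √3 * (Fl a - Fl (1 / 2)) := by
  have hsub : Set.uIcc (1 / 2) a ⊆ Set.Ici (1 / 2 : ℝ) := by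
    rw [Set.uIcc_of_le h1]; exact fun x hx => hx.1
  have hi : IntervalIntegrable (fun t : ℝ => 2 / √3 * (π - 3 * Real.arccos (1 / √(6 * t - 2)))) volume (1 / 2) a :=
    (continuousOn_const.mul (fcont.mono hsub)).intervalIntegrable
  have hint : ∫ t in (1 / 2)..a, 2 / √3 * (π - 3 * Real.arccos (1 / √(6 * t - 2))) =
      2 / √3 * (Fl a - Fl (1 / 2)) := by
    rw [intervalIntegral.integral_eq_sub_of_hasDerivAt_of_le (f := fun t => 2 / √3 * Fl t) h1 ?_ ?_ hi]
    · ring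
    · exact continuousOn_const.mul (Fl_cont.mono fun x hx => hx.1)
    · intro x hx
      exact (arg_eq hx.1).const_mul _
  have hnn : ∀ t ∈ Set.Ioc (1 / 2) a, 0 ≤ 2 / √3 * (π - 3 * Real.arccos (1 / √(6 * t - 2))) :=
    fun t ht => mul_nonneg (by positivity) (f_nonneg ht.1.le (ht.2.trans h2))
  rw [← hint]
  refine ⟨?_, ?_⟩
  · rw [intervalIntegral.integral_of_le h1,
      ofReal_integral_eq_lintegral_ofReal ((intervalIntegrable_iff_integrableOn_Ioc_of_le h1).1 hi)
        ((ae_restrict_iff' measurableSet_Ioc).2 (Filter.Eventually.of_forall hnn))]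
    refine setLIntegral_congr_fun measurableSet_Ioc fun t ht => ?_
    simp only [ff]
    rw [if_neg (not_lt.2 ht.1.le)]
  · rw [intervalIntegral.integral_of_le h1]
    exact setIntegral_nonneg measurableSet_Ioc hnn

lemma int_small {a : ℝ} (h1 : 1 / 3 ≤ a) (h2 : a ≤ 1 / 2) :
    ∫⁻ t in Set.Icc (1 / 3) a, ENNReal.ofReal (ff t) = ENNReal.ofReal (2 / √3 * π * (a - 1 / 3)) := by
  rw [← setLIntegral_congr Ico_ae_eq_Icc]
  have : ∫⁻ t in Set.Ico (1 / 3) a, ENNReal.ofReal (ff t) =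
      ∫⁻ t in Set.Ico (1 / 3) a, ENNReal.ofReal (2 / √3 * π) := by
    refine setLIntegral_congr_fun measurableSet_Ico fun t ht => ?_
    simp only [ff]
    rw [if_pos (ht.2.trans_le h2)]
  rw [this, setLIntegral_const, Real.volume_Ico, ← ENNReal.ofReal_mul (by positivity)]

lemma int_large_full {a : ℝ} (h1 : 1 / 2 ≤ a) (h2 : a ≤ 1) :
    ∫⁻ t in Set.Icc (1 / 3) a, ENNReal.ofReal (ff t) = ENNReal.ofReal (2 / √3 * Fl a) := by
  rw [← Set.Icc_union_Ioc_eq_Icc (show (1:ℝ) / 3 ≤ 1 / 2 by norm_num) h1,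
    lintegral_union measurableSet_Ioc, int_small (by norm_num) le_rfl, (int_large h1 h2).1,
    ← ENNReal.ofReal_add ?_ (int_large h1 h2).2]
  · congr 1
    rw [Fl_half]
    ring
  · have := Real.pi_pos
    exact mul_nonneg (by positivity) (by norm_num)
  · rw [Set.disjoint_left]
    intro x hx hx2
    exact absurd hx2.1 (not_lt.2 hx.2)

lemma map_eq : Measure.map (fun x : Fin 3 → ℝ => (∑ i, (x i) ^ 2) / (∑ i, x i) ^ 2) (expPi 3) =
      (volume.restrict (Set.Icc (1 / 3 : ℝ) 1)).withDensity (fun t => ENNReal.ofReal (ff t)) := by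
  have hp : IsProbabilityMeasure (expMeasure 1) := isProbabilityMeasure_expMeasure one_pos
  have hP : IsProbabilityMeasure (expPi 3) := by unfold expPi; infer_instance
  have hM := Measure.isProbabilityMeasure_map (μ := expPi 3) measurable_Y.aemeasurable
  apply Measure.ext_of_Iic
  intro a
  rw [Measure.map_apply measurable_Y measurableSet_Iic, withDensity_apply _ measurableSet_Iic,
    Measure.restrict_restrict measurableSet_Iic]
  change (expPi 3) {x | (∑ i, (x i) ^ 2) / (∑ i, x i) ^ 2 ≤ a} = _
  rcases lt_or_ge a (1 / 3) with h | h
  · have e : Set.Iic a ∩ Set.Icc (1 / 3 : ℝ) 1 = ∅ := by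
      ext x
      simp only [Set.mem_inter_iff, Set.mem_Iic, Set.mem_Icc, Set.mem_empty_iff_false, iff_false]
      rintro ⟨h1, h2, h3⟩
      linarith
    rw [e, Measure.restrict_empty, lintegral_zero_measure, ← nonpos_iff_eq_zero]
    calc _ ≤ (expPi 3) {x | (∑ i, (x i) ^ 2) / (∑ i, x i) ^ 2 ≤ 1 / 3} :=
          measure_mono fun x hx => le_trans (show _ ≤ a from hx) h.le
      _ = 0 := by rw [cdf_small _ le_rfl (by norm_num)]; simp
      _ ≤ 0 := le_rfl
  rcases le_or_gt a 1 with h1 | h1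
  · have e : Set.Iic a ∩ Set.Icc (1 / 3 : ℝ) 1 = Set.Icc (1 / 3) a := by
      ext x
      simp only [Set.mem_inter_iff, Set.mem_Iic, Set.mem_Icc]
      constructor
      · rintro ⟨h1, h2, h3⟩; exact ⟨h2, h1⟩
      · rintro ⟨h2, h3⟩; exact ⟨h3, h2, by linarith⟩
    rw [e]
    rcases lt_or_ge a (1 / 2) with h2 | h2
    · rw [cdf_small a h h2, int_small h h2.le]
    · rw [cdf_large a h2 h1, int_large_full h2 h1]
  · have e : Set.Iic a ∩ Set.Icc (1 / 3 : ℝ) 1 = Set.Icc (1 / 3) 1 := by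
      ext x
      simp only [Set.mem_inter_iff, Set.mem_Iic, Set.mem_Icc]
      constructor
      · rintro ⟨h1, h2, h3⟩; exact ⟨h2, h3⟩
      · rintro ⟨h2, h3⟩; exact ⟨by linarith, h2, h3⟩
    rw [e, int_large_full (by norm_num) le_rfl, ← cdf_large 1 (by norm_num) le_rfl]
    apply measure_congr
    filter_upwards [ae_Y] with x hx
    apply propext
    exact ⟨fun _ => hx.2, fun _ => hx.2.trans h1.le⟩

/-- For i.i.d. standard exponentials `ξ₁, ξ₂, ξ₃` and
`Y = (ξ₁²+ξ₂²+ξ₃²)/(ξ₁+ξ₂+ξ₃)²`: `Y` takes values in `[1/3, 1]` (a.s.), its cdf is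
`(2/√3)π(t-1/3)` on `[1/3, 1/2)` and
`(2/√3)[(t-1/3)(π - 3 arccos(1/√(6t-2))) + (√6/2)√(t-1/2)]` on `[1/2, 1]`, and `Y` has
density `(2/√3)π` on `[1/3, 1/2)` and `(2/√3)(π - 3 arccos(1/√(6t-2)))` on `[1/2, 1]`. -/
theorem exp_ratio_cdf_three :
    (∀ᵐ x ∂(expPi 3), (∑ i, (x i) ^ 2) / (∑ i, x i) ^ 2 ∈ Set.Icc (1 / 3 : ℝ) 1)
    ∧
    (∀ t : ℝ, 1 / 3 ≤ t → t < 1 / 2 →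
      (expPi 3) {x | (∑ i, (x i) ^ 2) / (∑ i, x i) ^ 2 ≤ t} =
        ENNReal.ofReal (2 / Real.sqrt 3 * π * (t - 1 / 3)))
    ∧
    (∀ t : ℝ, 1 / 2 ≤ t → t ≤ 1 →
      (expPi 3) {x | (∑ i, (x i) ^ 2) / (∑ i, x i) ^ 2 ≤ t} =
        ENNReal.ofReal (2 / Real.sqrt 3 *
          ((t - 1 / 3) * (π - 3 * Real.arccos (1 / Real.sqrt (6 * t - 2))) +
            Real.sqrt 6 / 2 * Real.sqrt (t - 1 / 2))))
    ∧
    Measure.map (fun x : Fin 3 → ℝ => (∑ i, (x i) ^ 2) / (∑ i, x i) ^ 2) (expPi 3) =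
      (volume.restrict (Set.Icc (1 / 3 : ℝ) 1)).withDensity
        (fun t => ENNReal.ofReal (if t < 1 / 2 then 2 / Real.sqrt 3 * π
          else 2 / Real.sqrt 3 * (π - 3 * Real.arccos (1 / Real.sqrt (6 * t - 2))))) := by
  exact ⟨ae_Y, cdf_small, cdf_large, map_eq⟩
end
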